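/- If two Boolean C-algebras B₁, B₂ (whose constant symbols generate the same subalgebra C) are both weakly equationally Noetherian, then they are geometrically equivalent. -/

import Mathlib

/-- Terms of the language of Boolean algebras extended by constants `cᵢ, i ∈ I`,
in the variables `x₁, …, xₙ`. -/
inductive BTerm (I : Type) (n : ℕ) : Type where
  | var : Fin n → BTerm I n
  | const : I → BTerm I n
  | bot : BTerm I n
  | top : BTerm I n
  | sup : BTerm I n → BTerm I n → BTerm I n
  | inf : BTerm I n → BTerm I n → BTerm I n
  | compl : BTerm I n → BTerm I n

/-- Evaluation of a term in a Boolean algebra `B`, where the constant symbols are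
interpreted via `c : I → B` and the variables via `b : Fin n → B`. -/
def BTerm.eval {I B : Type} [BooleanAlgebra B] (c : I → B) {n : ℕ} :
    BTerm I n → (Fin n → B) → B
  | .var i, b => b i
  | .const j, _ => c j
  | .bot, _ => ⊥
  | .top, _ => ⊤
  | .sup t s, b => t.eval c b ⊔ s.eval c b
  | .inf t s, b => t.eval c b ⊓ s.eval c b
  | .compl t, b => (t.eval c b)ᶜ

/-- An equation `t(X) = s(X)` is a pair of terms. -/
abbrev BEqn (I : Type) (n : ℕ) := BTerm I n × BTerm I n

/-- The solution set `V_B(S)` of a system of equations `S`. -/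
def solSet {I B : Type} [BooleanAlgebra B] (c : I → B) {n : ℕ}
    (S : Set (BEqn I n)) : Set (Fin n → B) :=
  {b | ∀ e ∈ S, e.1.eval c b = e.2.eval c b}

/-- The subalgebra `C ⊆ B` generated by the interpretations of the constants:
the set of values of all closed terms. -/
def constSubalg {I B : Type} [BooleanAlgebra B] (c : I → B) : Set B :=
  Set.range fun t : BTerm I 0 => t.eval c (fun i => i.elim0)

/-- The radical `Rad_B(S)`: the set of all equations that hold on `V_B(S)`. -/
def radical {I B : Type} [BooleanAlgebra B] (c : I → B) {n : ℕ}
    (S : Set (BEqn I n)) : Set (BEqn I n) :=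
  {e | solSet c S ⊆ solSet c {e}}

/-- Two Boolean C-algebras are geometrically equivalent if every system of
equations has the same radical over both of them. -/
def GeomEquiv {I B₁ B₂ : Type} [BooleanAlgebra B₁] [BooleanAlgebra B₂]
    (c₁ : I → B₁) (c₂ : I → B₂) : Prop :=
  ∀ (n : ℕ) (S : Set (BEqn I n)), radical c₁ S = radical c₂ S

/-- The constant symbols generate the same subalgebra `C` in both algebras:
two closed terms have equal values in `B₁` iff they have equal values in `B₂`
(so the subalgebras generated by the constants are canonically isomorphic). -/
def SameConstAlg {I B₁ B₂ : Type} [BooleanAlgebra B₁] [BooleanAlgebra B₂]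
    (c₁ : I → B₁) (c₂ : I → B₂) : Prop :=
  ∀ t s : BTerm I 0,
    t.eval c₁ (fun i => i.elim0) = s.eval c₁ (fun i => i.elim0) ↔
    t.eval c₂ (fun i => i.elim0) = s.eval c₂ (fun i => i.elim0)

/-- `B` is weakly equationally Noetherian: every system is equivalent over `B` to
some finite system (not necessarily a subsystem). -/
def WeaklyEqNoetherian {I B : Type} [BooleanAlgebra B] (c : I → B) : Prop :=
  ∀ (n : ℕ) (S : Set (BEqn I n)),
    ∃ S' : Set (BEqn I n), S'.Finite ∧ solSet c S' = solSet c S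

/-- Substitution of terms for variables. -/
def BTerm.subst' {I : Type} {n m : ℕ} (σ : Fin n → BTerm I m) : BTerm I n → BTerm I m
  | .var i => σ i
  | .const j => .const j
  | .bot => .bot
  | .top => .top
  | .sup t s => .sup (t.subst' σ) (s.subst' σ)
  | .inf t s => .inf (t.subst' σ) (s.subst' σ)
  | .compl t => .compl (t.subst' σ)

theorem BTerm.eval_subst' {I B : Type} [BooleanAlgebra B] (c : I → B) {n m : ℕ}
    (σ : Fin n → BTerm I m) (t : BTerm I n) (b : Fin m → B) :
    (t.subst' σ).eval c b = t.eval c (fun i => (σ i).eval c b) := by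
  induction t <;> simp_all [BTerm.subst', BTerm.eval]

theorem BTerm.eval_local {I B : Type} [BooleanAlgebra B] (c : I → B) {n : ℕ}
    (t : BTerm I n) (b b' : Fin n → B) (y : B) (h : ∀ i, b i ⊓ y = b' i ⊓ y) :
    t.eval c b ⊓ y = t.eval c b' ⊓ y := by
  have key : ∀ a : B, aᶜ ⊓ y = (a ⊓ y)ᶜ ⊓ y := by
    intro a
    rw [compl_inf, inf_sup_right, compl_inf_eq_bot, sup_bot_eq]
  induction t with
  | var i => exact h i
  | const j => rfl
  | bot => rfl
  | top => rfl
  | sup t s iht ihs => simp only [BTerm.eval, inf_sup_right, iht, ihs]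
  | inf t s iht ihs =>
    simp only [BTerm.eval]
    rw [inf_inf_distrib_right, iht, ihs, ← inf_inf_distrib_right]
  | compl t iht =>
    simp only [BTerm.eval]
    rw [key, iht, ← key]

theorem BTerm.eval_cons_inf {I B : Type} [BooleanAlgebra B] (c : I → B) {n : ℕ}
    (t : BTerm I (n + 1)) (x : B) (b : Fin n → B) :
    t.eval c (Fin.cons x b) ⊓ x = t.eval c (Fin.cons ⊤ b) ⊓ x := by
  apply BTerm.eval_local
  intro i
  refine Fin.cases ?_ (fun j => ?_) i <;> simp

theorem BTerm.eval_cons_inf_compl {I B : Type} [BooleanAlgebra B] (c : I → B) {n : ℕ}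
    (t : BTerm I (n + 1)) (x : B) (b : Fin n → B) :
    t.eval c (Fin.cons x b) ⊓ xᶜ = t.eval c (Fin.cons ⊥ b) ⊓ xᶜ := by
  apply BTerm.eval_local
  intro i
  refine Fin.cases ?_ (fun j => ?_) i <;> simp

theorem eq_bot_of_inf_compl' {B : Type} [BooleanAlgebra B] {a x : B}
    (h1 : a ⊓ x = ⊥) (h2 : a ⊓ xᶜ = ⊥) : a = ⊥ := by
  rw [← sup_inf_inf_compl (x := a) (y := x), h1, h2, sup_bot_eq]

/-- Elimination of one variable. -/
theorem elim_one {I B : Type} [BooleanAlgebra B] (c : I → B) {n : ℕ}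
    (t s : BTerm I (n + 1)) (x : B) (b : Fin n → B)
    (ht : t.eval c (Fin.cons x b) = ⊥) (hs : s.eval c (Fin.cons x b) ≠ ⊥) :
    ∃ d : BTerm I n, t.eval c (Fin.cons (d.eval c b) b) = ⊥ ∧
      s.eval c (Fin.cons (d.eval c b) b) ≠ ⊥ := by
  have h1 := t.eval_cons_inf c x b
  have h0 := t.eval_cons_inf_compl c x b
  rw [ht, bot_inf_eq] at h1 h0
  have d1 : x ≤ (t.eval c (Fin.cons ⊤ b))ᶜ :=
    (disjoint_iff.2 h1.symm).symm.le_compl_right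
  have d0 : t.eval c (Fin.cons ⊥ b) ≤ x :=
    disjoint_compl_right_iff.1 (disjoint_iff.2 h0.symm)
  have d01 : t.eval c (Fin.cons ⊤ b) ⊓ t.eval c (Fin.cons ⊥ b) = ⊥ :=
    le_bot_iff.1 ((inf_le_inf_left _ d0).trans h1.symm.le)
  have ev : ∀ r : BTerm I n, ∀ u : BTerm I (n + 1),
      (u.subst' (Fin.cons r BTerm.var)).eval c b = u.eval c (Fin.cons (r.eval c b) b) := by
    intro r u
    rw [BTerm.eval_subst']
    congr 1
    funext i
    refine Fin.cases ?_ (fun j => ?_) i <;> simp [BTerm.eval]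
  have evt := ev .top t
  have evb := ev .bot t
  simp only [BTerm.eval] at evt evb
  by_cases hx : s.eval c (Fin.cons x b) ⊓ x = ⊥
  · have hx' : s.eval c (Fin.cons x b) ⊓ xᶜ ≠ ⊥ := fun h => hs (eq_bot_of_inf_compl' hx h)
    rw [BTerm.eval_cons_inf_compl] at hx'
    refine ⟨t.subst' (Fin.cons .bot BTerm.var), ?_, ?_⟩
    · rw [evb]
      apply eq_bot_of_inf_compl'
      · rw [BTerm.eval_cons_inf, d01]
      · rw [BTerm.eval_cons_inf_compl, inf_compl_eq_bot]
    · rw [evb]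
      intro h
      have := s.eval_cons_inf_compl c (t.eval c (Fin.cons ⊥ b)) b
      rw [h, bot_inf_eq] at this
      exact hx' (le_bot_iff.1 ((inf_le_inf_left _ (compl_le_compl d0)).trans this.symm.le))
  · rw [BTerm.eval_cons_inf] at hx
    refine ⟨.compl (t.subst' (Fin.cons .top BTerm.var)), ?_, ?_⟩
    · simp only [BTerm.eval]
      rw [evt]
      apply eq_bot_of_inf_compl'
      · rw [BTerm.eval_cons_inf, inf_compl_eq_bot]
      · rw [BTerm.eval_cons_inf_compl, compl_compl, inf_comm, d01]
    · simp only [BTerm.eval]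
      rw [evt]
      intro h
      have := s.eval_cons_inf c (t.eval c (Fin.cons ⊤ b))ᶜ b
      rw [h, bot_inf_eq] at this
      exact hx (le_bot_iff.1 ((inf_le_inf_left _ d1).trans this.symm.le))

theorem elim_all {I B : Type} [BooleanAlgebra B] (c : I → B) {n : ℕ} :
    ∀ (t s : BTerm I n) (b : Fin n → B) (_ : t.eval c b = ⊥) (_ : s.eval c b ≠ ⊥),
    ∃ d : Fin n → BTerm I 0, (t.subst' d).eval c (fun i => i.elim0) = ⊥ ∧
      (s.subst' d).eval c (fun i => i.elim0) ≠ ⊥ := by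
  induction n with
  | zero =>
    intro t s b ht hs
    refine ⟨fun i => i.elim0, ?_, ?_⟩
    · rw [BTerm.eval_subst', ← ht]
      congr 1
      funext i
      exact i.elim0
    · rw [BTerm.eval_subst']
      convert hs using 2
  | succ n ih =>
    intro t s b ht hs
    rw [← Fin.cons_self_tail b] at ht hs
    obtain ⟨r, h1, h2⟩ := elim_one c t s _ _ ht hs
    have ev : ∀ u : BTerm I (n + 1), (u.subst' (Fin.cons r BTerm.var)).eval c (Fin.tail b)
        = u.eval c (Fin.cons (r.eval c (Fin.tail b)) (Fin.tail b)) := by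
      intro u
      rw [BTerm.eval_subst']
      congr 1
      funext i
      refine Fin.cases ?_ (fun j => ?_) i <;> simp [BTerm.eval]
    rw [← ev] at h1 h2
    obtain ⟨d, h3, h4⟩ := ih _ _ _ h1 h2
    refine ⟨fun i => ((Fin.cons r BTerm.var : Fin (n + 1) → BTerm I n) i).subst' d, ?_, ?_⟩
    · simpa only [BTerm.eval_subst'] using h3
    · simpa only [BTerm.eval_subst'] using h4

theorem finite_term {I : Type} {n : ℕ} (S : Set (BEqn I n)) (hS : S.Finite) :
    ∃ t : BTerm I n, ∀ (B : Type) [BooleanAlgebra B] (c : I → B) (b : Fin n → B),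
      b ∈ solSet c S ↔ t.eval c b = ⊥ := by
  induction S, hS using Set.Finite.induction_on with
  | empty => exact ⟨.bot, fun B _ c b => by simp [solSet, BTerm.eval]⟩
  | @insert e S _ _ ih =>
    obtain ⟨t, ht⟩ := ih
    refine ⟨.sup (.sup (.inf e.1 (.compl e.2)) (.inf e.2 (.compl e.1))) t, ?_⟩
    intro B _ c b
    have h1 : b ∈ solSet c (insert e S) ↔ e.1.eval c b = e.2.eval c b ∧ b ∈ solSet c S := by
      simp [solSet]
    rw [h1, ht]
    simp only [BTerm.eval, sup_eq_bot_iff, ← disjoint_iff, disjoint_compl_right_iff]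
    rw [le_antisymm_iff]

theorem transfer_finite {I B₁ B₂ : Type} [BooleanAlgebra B₁] [BooleanAlgebra B₂]
    (c₁ : I → B₁) (c₂ : I → B₂) (hC : SameConstAlg c₁ c₂) {n : ℕ}
    (S T : Set (BEqn I n)) (hS : S.Finite) (hT : T.Finite)
    (h : solSet c₁ S ⊆ solSet c₁ T) : solSet c₂ S ⊆ solSet c₂ T := by
  obtain ⟨t, ht⟩ := finite_term S hS
  obtain ⟨s, hs⟩ := finite_term T hT
  intro b hb
  by_contra hn
  rw [ht] at hb
  rw [hs] at hn
  obtain ⟨d, h1, h2⟩ := elim_all c₂ t s b hb hn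
  have h1' := (hC (t.subst' d) .bot).2 h1
  apply h2
  refine (hC (s.subst' d) .bot).1 ?_
  simp only [BTerm.eval, BTerm.eval_subst'] at h1' ⊢
  rw [← ht] at h1'
  rw [← hs]
  exact h h1'

theorem radical_sub {I B₁ B₂ : Type} [BooleanAlgebra B₁] [BooleanAlgebra B₂]
    (c₁ : I → B₁) (c₂ : I → B₂) (hC : SameConstAlg c₁ c₂)
    (h₁ : WeaklyEqNoetherian c₁) (h₂ : WeaklyEqNoetherian c₂) {n : ℕ} (S : Set (BEqn I n)) :
    radical c₁ S ⊆ radical c₂ S := by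
  intro f hf
  obtain ⟨S₂, hfin, heq⟩ := h₂ n S
  have hC' : SameConstAlg c₂ c₁ := fun t s => (hC t s).symm
  have key : solSet c₁ S₂ ⊆ solSet c₁ S := by
    intro b hb e he
    have h3 : solSet c₂ S₂ ⊆ solSet c₂ {e} := by
      rw [heq]
      intro x hx e' he'
      rw [Set.mem_singleton_iff.1 he']
      exact hx e he
    exact transfer_finite c₂ c₁ hC' S₂ {e} hfin (Set.finite_singleton e) h3 hb e rfl
  change solSet c₂ S ⊆ solSet c₂ {f}
  rw [← heq]
  exact transfer_finite c₁ c₂ hC S₂ {f} hfin (Set.finite_singleton f) (key.trans hf)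

/-- Theorem 9(3): two weakly equationally Noetherian Boolean C-algebras with the
same subalgebra of constants are geometrically equivalent. -/
theorem geomEquiv_of_weaklyEqNoetherian {I B₁ B₂ : Type}
    [BooleanAlgebra B₁] [BooleanAlgebra B₂]
    (c₁ : I → B₁) (c₂ : I → B₂) (hC : SameConstAlg c₁ c₂)
    (h₁ : WeaklyEqNoetherian c₁) (h₂ : WeaklyEqNoetherian c₂) :
    GeomEquiv c₁ c₂ := by
  intro n S
  exact Set.Subset.antisymm (radical_sub c₁ c₂ hC h₁ h₂ S)
    (radical_sub c₂ c₁ (fun t s => (hC t s).symm) h₂ h₁ S)
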